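/- Let F be a field of characteristic different from 2, λ ∈ F nonzero, L = Lei₄(3,F), G = Aut(L), and C = C_G(L/ζ(L)) = {f ∈ G : f(x) − x ∈ ζ(L) for all x ∈ L}. Then the quotient group G/C is isomorphic to the subgroup of GL₂(F) consisting of all invertible matrices of the form [[α₁, δλα₂],[α₂, −δα₁]] with α₁, α₂ ∈ F and δ ∈ {1, −1}. -/

import Mathlib

/-- A (left) Leibniz algebra over a field `F`: a vector space with a bilinear
bracket satisfying the left Leibniz identity. -/
structure LeibnizAlg (F : Type*) [Field F] (L : Type*) [AddCommGroup L] [Module F L] where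
  bracket : L →ₗ[F] L →ₗ[F] L
  leibniz : ∀ a b c : L,
    bracket (bracket a b) c = bracket a (bracket b c) - bracket b (bracket a c)

namespace LeibnizAlg

variable {F : Type*} [Field F] {L : Type*} [AddCommGroup L] [Module F L]

/-- The left center `ζ^left(L)`. -/
def leftCenter (A : LeibnizAlg F L) : Submodule F L where
  carrier := {x | ∀ y : L, A.bracket x y = 0}
  add_mem' := by
    intro a b ha hb y
    simp [map_add, LinearMap.add_apply, ha y, hb y]
  zero_mem' := by intro y; simp
  smul_mem' := by
    intro c x hx y
    simp [map_smul, LinearMap.smul_apply, hx y]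

/-- The right center `ζ^right(L)`. -/
def rightCenter (A : LeibnizAlg F L) : Submodule F L where
  carrier := {x | ∀ y : L, A.bracket y x = 0}
  add_mem' := by
    intro a b ha hb y
    simp [ha y, hb y]
  zero_mem' := by intro y; simp
  smul_mem' := by
    intro c x hx y
    simp [hx y]

/-- The center `ζ(L)`. -/
def center (A : LeibnizAlg F L) : Submodule F L := A.leftCenter ⊓ A.rightCenter

/-- The derived subalgebra `[L,L]`. -/
def derived (A : LeibnizAlg F L) : Submodule F L :=
  Submodule.span F {z | ∃ a b : L, z = A.bracket a b}

/-- The Leibniz kernel `Leib(L)`, spanned by the squares `[a,a]`. -/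
def leibKernel (A : LeibnizAlg F L) : Submodule F L :=
  Submodule.span F {z | ∃ a : L, z = A.bracket a a}

/-- Upper central series: `upper 0 = ⊥ = ζ₀(L)`, `upper (n+1) = ζ_{n+1}(L)`. -/
def upper (A : LeibnizAlg F L) : ℕ → Submodule F L
  | 0 => ⊥
  | n + 1 =>
    { carrier := {x | ∀ y : L, A.bracket x y ∈ A.upper n ∧ A.bracket y x ∈ A.upper n}
      add_mem' := by
        intro a b ha hb y
        constructor
        · simpa [map_add, LinearMap.add_apply] using add_mem (ha y).1 (hb y).1
        · simpa [map_add] using add_mem (ha y).2 (hb y).2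
      zero_mem' := by
        intro y
        constructor <;> simp
      smul_mem' := by
        intro c x hx y
        constructor
        · simpa [map_smul, LinearMap.smul_apply] using Submodule.smul_mem _ c (hx y).1
        · simpa [map_smul] using Submodule.smul_mem _ c (hx y).2 }

/-- Lower central series: `lower 0 = ⊤ = γ₁(L)`, `lower n = γ_{n+1}(L)`. -/
def lower (A : LeibnizAlg F L) : ℕ → Submodule F L
  | 0 => ⊤
  | n + 1 => Submodule.span F {z | ∃ x a : L, a ∈ A.lower n ∧ z = A.bracket x a}

/-- The automorphism group of a Leibniz algebra, as a subgroup of the group of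
linear automorphisms of the underlying vector space. -/
def Aut (A : LeibnizAlg F L) : Subgroup (L ≃ₗ[F] L) where
  carrier := {f | ∀ a b : L, f (A.bracket a b) = A.bracket (f a) (f b)}
  mul_mem' := by
    intro f g hf hg a b
    show f (g (A.bracket a b)) = A.bracket (f (g a)) (f (g b))
    rw [hg, hf]
  one_mem' := by intro a b; rfl
  inv_mem' := by
    intro f hf a b
    apply f.injective
    show f (f.symm (A.bracket a b)) = f (A.bracket (f.symm a) (f.symm b))
    rw [hf, f.apply_symm_apply, f.apply_symm_apply, f.apply_symm_apply]

/-- The group `B(V,Φ)` of linear automorphisms of `V` preserving the bilinear form `Φ`. -/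
def formPreserving (F : Type*) [Field F] (V : Type*) [AddCommGroup V] [Module F V]
    (Φ : V →ₗ[F] V →ₗ[F] F) : Subgroup (V ≃ₗ[F] V) where
  carrier := {g | ∀ x y : V, Φ (g x) (g y) = Φ x y}
  mul_mem' := by
    intro f g hf hg x y
    show Φ (f (g x)) (f (g y)) = Φ x y
    rw [hf, hg]
  one_mem' := by intro x y; rfl
  inv_mem' := by
    intro f hf x y
    have h := hf (f.symm x) (f.symm y)
    rw [f.apply_symm_apply, f.apply_symm_apply] at h
    exact h.symm

/-- The subalgebra generated by an element `b`. -/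
def genBy (A : LeibnizAlg F L) (b : L) : Submodule F L :=
  sInf {S : Submodule F L | b ∈ S ∧ ∀ x ∈ S, ∀ y ∈ S, A.bracket x y ∈ S}

end LeibnizAlg

/-- The bilinear bracket of the algebra `Lei₄(3,F)`:
`[x,y] = (x₀y₀ + λ x₁y₁)·a₃` where `a₃ = (0,0,1)`. -/
def leiBracket (F : Type*) [Field F] (lam : F) :
    (Fin 3 → F) →ₗ[F] (Fin 3 → F) →ₗ[F] (Fin 3 → F) :=
  LinearMap.mk₂ F (fun x y => (x 0 * y 0 + lam * (x 1 * y 1)) • (![0, 0, 1] : Fin 3 → F))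
    (by
      intro x x' y
      rw [← add_smul]
      simp only [Pi.add_apply]
      ring_nf)
    (by
      intro c x y
      rw [smul_smul]
      simp only [Pi.smul_apply, smul_eq_mul]
      ring_nf)
    (by
      intro x y y'
      rw [← add_smul]
      simp only [Pi.add_apply]
      ring_nf)
    (by
      intro c x y
      rw [smul_smul]
      simp only [Pi.smul_apply, smul_eq_mul]
      ring_nf)

/-- The Leibniz algebra `Lei₄(3,F)` with parameter `λ`. -/
def lei4 (F : Type*) [Field F] (lam : F) : LeibnizAlg F (Fin 3 → F) where
  bracket := leiBracket F lam
  leibniz := by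
    intro a b c
    simp [leiBracket, LinearMap.mk₂_apply]

theorem lei4_bracket_apply (F : Type*) [Field F] (lam : F) (x y : Fin 3 → F) :
    (lei4 F lam).bracket x y = ![0, 0, x 0 * y 0 + lam * (x 1 * y 1)] := by
  change (x 0 * y 0 + lam * (x 1 * y 1)) • (![0, 0, 1] : Fin 3 → F) = _
  ext i
  fin_cases i <;> simp

theorem lei4_mem_center (F : Type*) [Field F] (lam : F) (hlam : lam ≠ 0) (x : Fin 3 → F) :
    x ∈ (lei4 F lam).center ↔ x 0 = 0 ∧ x 1 = 0 := by
  constructor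
  · rintro ⟨h, -⟩
    have h0 := congrFun (h ![1, 0, 0]) 2
    have h1 := congrFun (h ![0, 1, 0]) 2
    rw [lei4_bracket_apply] at h0 h1
    simp [hlam] at h0 h1
    exact ⟨h0, h1⟩
  · rintro ⟨h0, h1⟩
    constructor
    · intro y
      rw [lei4_bracket_apply]
      ext i
      fin_cases i <;> simp [h0, h1]
    · intro y
      rw [lei4_bracket_apply]
      ext i
      fin_cases i <;> simp [h0, h1]

theorem lei4_expand {F : Type*} [Field F] (f : (Fin 3 → F) ≃ₗ[F] (Fin 3 → F)) (x : Fin 3 → F)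
    (i : Fin 3) : f x i = x 0 * f ![1, 0, 0] i + x 1 * f ![0, 1, 0] i + x 2 * f ![0, 0, 1] i := by
  have h : x = x 0 • ![1, 0, 0] + x 1 • ![0, 1, 0] + x 2 • ![0, 0, 1] := by
    ext j
    fin_cases j <;> simp
  conv_lhs => rw [h]
  simp only [map_add, map_smul, Pi.add_apply, Pi.smul_apply, smul_eq_mul]

theorem lei4_aut_e2 {F : Type*} [Field F] {lam : F} (f : (lei4 F lam).Aut) :
    f.1 ![0, 0, 1] =
      ![0, 0, f.1 ![1, 0, 0] 0 * f.1 ![1, 0, 0] 0 + lam * (f.1 ![1, 0, 0] 1 * f.1 ![1, 0, 0] 1)] := by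
  have h := f.2 ![1, 0, 0] ![1, 0, 0]
  rw [lei4_bracket_apply, lei4_bracket_apply] at h
  simpa using h

/-- The action on the quotient by the center, as a matrix. -/
def lei4Mat {F : Type*} [Field F] {lam : F} (f : (lei4 F lam).Aut) : Matrix (Fin 2) (Fin 2) F :=
  !![f.1 ![1, 0, 0] 0, f.1 ![0, 1, 0] 0; f.1 ![1, 0, 0] 1, f.1 ![0, 1, 0] 1]

/-- `lei4Mat` as a monoid homomorphism. -/
def lei4Hom (F : Type*) [Field F] (lam : F) : (lei4 F lam).Aut →* Matrix (Fin 2) (Fin 2) F where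
  toFun := lei4Mat
  map_one' := by
    ext i j
    fin_cases i <;> fin_cases j <;> simp [lei4Mat]
  map_mul' := by
    intro f g
    have e := lei4_aut_e2 f
    ext i j
    fin_cases i <;> fin_cases j <;>
      simp [lei4Mat, Matrix.mul_apply, Fin.sum_univ_two] <;>
      rw [lei4_expand f.1 (g.1 _), e] <;> simp <;> ring

theorem lei4_aut_form {F : Type*} [Field F] {lam : F} (hlam : lam ≠ 0) (f : (lei4 F lam).Aut) :
    ∃ α₁ α₂ δ : F, (δ = 1 ∨ δ = -1) ∧ lei4Mat f = !![α₁, δ * lam * α₂; α₂, -(δ * α₁)] := by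
  have e2 := lei4_aut_e2 f
  have h01 := f.2 ![1, 0, 0] ![0, 1, 0]
  have h11 := f.2 ![0, 1, 0] ![0, 1, 0]
  rw [lei4_bracket_apply, lei4_bracket_apply] at h01 h11
  have k01 := congrFun h01 2
  have k11 := congrFun h11 2
  have hz : f.1 ![0, 0, 0] = 0 := by
    rw [show (![0, 0, 0] : Fin 3 → F) = 0 by ext j; fin_cases j <;> simp, map_zero]
  have hl : f.1 ![0, 0, lam] = lam • f.1 ![0, 0, 1] := by
    rw [← map_smul]; congr 1; ext j; fin_cases j <;> simp
  have hs : f.1 ![1, 0, 0] 0 * f.1 ![1, 0, 0] 0 + lam * (f.1 ![1, 0, 0] 1 * f.1 ![1, 0, 0] 1) ≠ 0 := by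
    intro h0
    rw [h0] at e2
    have : (![0, 0, 1] : Fin 3 → F) = 0 := by
      apply f.1.injective
      rw [e2, map_zero]
      ext j; fin_cases j <;> simp
    simpa using congrFun this 2
  simp [hz] at k01
  simp [hl, e2] at k11
  unfold lei4Mat
  generalize f.1 ![1, 0, 0] 0 = a at *
  generalize f.1 ![1, 0, 0] 1 = b at *
  generalize f.1 ![0, 1, 0] 0 = c at *
  generalize f.1 ![0, 1, 0] 1 = d at *
  -- now pure algebra
  obtain ⟨t, ht⟩ : ∃ t, t * (a * a + lam * (b * b)) = a * d - b * c := ⟨_, div_mul_cancel₀ _ hs⟩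
  have hc : c = -t * lam * b := by
    apply mul_right_cancel₀ hs
    linear_combination (lam * b) * ht - a * k01
  have hd : d = t * a := by
    apply mul_right_cancel₀ hs
    linear_combination -a * ht - b * k01
  have ht2 : t * t = 1 := by
    apply mul_right_cancel₀ (mul_ne_zero hlam hs)
    subst hc hd
    linear_combination -k11
  refine ⟨a, b, -t, ?_, ?_⟩
  · rcases mul_self_eq_one_iff.1 ht2 with h | h <;> simp [h]
  · rw [hc, hd]
    simp

/-- The automorphism attached to a matrix of the given form. -/
def lei4Equiv {F : Type*} [Field F] (lam a b δ : F) (hδ : δ * δ = 1)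
    (hs : a * a + lam * (b * b) ≠ 0) : (Fin 3 → F) ≃ₗ[F] (Fin 3 → F) where
  toFun x := ![a * x 0 + δ * lam * b * x 1, b * x 0 - δ * a * x 1, (a * a + lam * (b * b)) * x 2]
  invFun y := ![(a * y 0 + lam * b * y 1) / (a * a + lam * (b * b)),
    δ * (b * y 0 - a * y 1) / (a * a + lam * (b * b)), y 2 / (a * a + lam * (b * b))]
  map_add' x y := by ext i; fin_cases i <;> simp <;> ring
  map_smul' r x := by ext i; fin_cases i <;> simp <;> ring
  left_inv x := by
    ext i
    fin_cases i <;> simp <;> rw [div_eq_iff hs]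
    · ring
    · linear_combination (x 1 * (a * a + lam * (b * b))) * hδ
    · ring
  right_inv y := by
    have hs2 : a ^ 2 + lam * b ^ 2 ≠ 0 := by
      intro h; apply hs; linear_combination h
    ext i
    have hs3 : b ^ 2 * lam + a ^ 2 ≠ 0 ∧ a ^ 2 + b ^ 2 * lam ≠ 0 ∧ lam * b ^ 2 + a ^ 2 ≠ 0 := by
      refine ⟨?_, ?_, ?_⟩ <;>
      · intro h; apply hs; linear_combination h
    obtain ⟨h3, h4, h5⟩ := hs3
    fin_cases i <;> simp <;> field_simp
    · linear_combination (lam * b * (b * y 0 - a * y 1)) * hδ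
    · linear_combination (-a * (b * y 0 - a * y 1)) * hδ

/-- for `L = Lei₄(3,F)` over a field of characteristic ≠ 2 and
`G = Aut(L)`, the quotient of `G` by `C = C_G(L/ζ(L))` is isomorphic to the
subgroup of `GL₂(F)` of invertible matrices `!![α₁, δλα₂; α₂, -δα₁]` with
`δ ∈ {1,-1}`.  This is expressed by a homomorphism `ψ : G →* GL₂(F)` whose
kernel is `C` and whose range consists exactly of these matrices, together with
the isomorphism `G/C = G/ker ψ ≅ ψ.range`. -/
theorem lei4_aut_quotient_char_ne_two
    (F : Type*) [Field F] (hchar : (2 : F) ≠ 0) (lam : F) (hlam : lam ≠ 0) :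
    ∃ ψ : (lei4 F lam).Aut →* GL (Fin 2) F,
      (∀ f : (lei4 F lam).Aut, f ∈ ψ.ker ↔
        ∀ x : Fin 3 → F,
          (f : (Fin 3 → F) ≃ₗ[F] (Fin 3 → F)) x - x ∈ (lei4 F lam).center) ∧
      (∀ M : GL (Fin 2) F, M ∈ ψ.range ↔
        ∃ α₁ α₂ δ : F, (δ = 1 ∨ δ = -1) ∧
          (M : Matrix (Fin 2) (Fin 2) F)
            = !![α₁, δ * lam * α₂; α₂, -(δ * α₁)]) ∧
      Nonempty (((lei4 F lam).Aut ⧸ ψ.ker) ≃* ψ.range) := by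
  refine ⟨(lei4Hom F lam).toHomUnits, ?_, ?_, ⟨QuotientGroup.quotientKerEquivRange _⟩⟩
  · intro f
    rw [MonoidHom.mem_ker, Units.ext_iff]
    change lei4Mat f = 1 ↔ _
    have e2 := lei4_aut_e2 f
    constructor
    · intro h x
      rw [lei4_mem_center F lam hlam]
      have h00 := congrFun (congrFun h 0) 0
      have h01 := congrFun (congrFun h 0) 1
      have h10 := congrFun (congrFun h 1) 0
      have h11 := congrFun (congrFun h 1) 1
      simp [lei4Mat] at h00 h01 h10 h11
      constructor <;> rw [Pi.sub_apply, lei4_expand f.1 x, e2]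
      · simp [h00, h01]
      · simp [h10, h11]
    · intro h
      have h0 := (lei4_mem_center F lam hlam _).1 (h ![1, 0, 0])
      have h1 := (lei4_mem_center F lam hlam _).1 (h ![0, 1, 0])
      simp [sub_eq_zero] at h0 h1
      ext i j
      fin_cases i <;> fin_cases j <;> simp [lei4Mat, h0, h1]
  · intro M
    constructor
    · rintro ⟨f, rfl⟩
      exact lei4_aut_form hlam f
    · rintro ⟨a, b, δ, hδ, hM⟩
      have hδ2 : δ * δ = 1 := by rcases hδ with h | h <;> simp [h]
      have hs : a * a + lam * (b * b) ≠ 0 := by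
        intro h0
        have hdet : (M : Matrix (Fin 2) (Fin 2) F).det ≠ 0 :=
          ((Matrix.isUnit_iff_isUnit_det _).1 M.isUnit).ne_zero
        apply hdet
        rw [hM, Matrix.det_fin_two_of]
        linear_combination (-δ) * h0
      refine ⟨⟨lei4Equiv lam a b δ hδ2 hs, ?_⟩, ?_⟩
      · intro x y
        rw [lei4_bracket_apply, lei4_bracket_apply]
        ext i
        fin_cases i <;> simp [lei4Equiv]
        linear_combination (-(lam * x 1 * y 1 * (a * a + lam * (b * b)))) * hδ2
      · apply Units.ext
        rw [hM]
        change lei4Mat _ = _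
        simp [lei4Mat, lei4Equiv]
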